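/- For every MBS (Σ, ar), the canonical inclusion e : T_Σ → T_Σ^∞ (regarding a raw finite term as a raw mixed term) is injective, satisfies trunc_n (e t) = trunc_n t for every n : ℕ (and hence is isometric for the Arnold–Nivat metrics on T_Σ and on T_Σ^∞), and its image is dense in the complete metric space (T_Σ^∞, d); consequently (T_Σ^∞, d) is a Cauchy completion of (T_Σ, d). -/

import Mathlib

set_option linter.unusedVariables false
set_option linter.unnecessarySeqFocus false

namespace Fanfic

/-- A mixed binding signature. -/
structure MBS (𝕍 : Type) : Type 1 where
  Cons : Type
  countable : Countable Cons
  ar : Cons → List (ℕ × Bool)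

variable {𝕍 : Type}

/-- Raw finite terms on a mixed binding signature. -/
inductive PreTm (𝕍 : Type) (S : MBS 𝕍) : Type where
  | var : 𝕍 → PreTm 𝕍 S
  | op (o : S.Cons)
      (binds : (i : Fin (S.ar o).length) → Fin ((S.ar o).get i).1 → 𝕍)
      (args : Fin (S.ar o).length → PreTm 𝕍 S) : PreTm 𝕍 S

/-- Raw finite terms over the signature extended with a fresh constant `∗`. -/
inductive TmStar (𝕍 : Type) (S : MBS 𝕍) : Type where
  | star : TmStar 𝕍 S
  | var : 𝕍 → TmStar 𝕍 S
  | op (o : S.Cons)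
      (binds : (i : Fin (S.ar o).length) → Fin ((S.ar o).get i).1 → 𝕍)
      (args : Fin (S.ar o).length → TmStar 𝕍 S) : TmStar 𝕍 S

def PreTm.toStar {S : MBS 𝕍} : PreTm 𝕍 S → TmStar 𝕍 S
  | .var x => .var x
  | .op o binds args => .op o binds (fun i => (args i).toStar)

/-- Mixed truncation at a given depth (of a term possibly containing `∗`). -/
def TmStar.trunc {S : MBS 𝕍} : TmStar 𝕍 S → ℕ → TmStar 𝕍 S
  | _, 0 => .star
  | .star, _ + 1 => .star
  | .var x, _ + 1 => .var x
  | .op o binds args, n + 1 =>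
      .op o binds (fun i => (args i).trunc (if ((S.ar o).get i).2 then n else n + 1))

/-- Mixed truncation of a raw finite term at a given depth. -/
def PreTm.trunc {S : MBS 𝕍} (t : PreTm 𝕍 S) (n : ℕ) : TmStar 𝕍 S :=
  t.toStar.trunc n

/-- The inner inductive layer `μX.F_Σ(X,Y)` of the mixed terms on a signature. -/
inductive Inner (𝕍 : Type) (S : MBS 𝕍) (Y : Type) : Type where
  | var : 𝕍 → Inner 𝕍 S Y
  | op (o : S.Cons)
      (binds : (i : Fin (S.ar o).length) → Fin ((S.ar o).get i).1 → 𝕍)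
      (argsI : (i : Fin (S.ar o).length) → ((S.ar o).get i).2 = false → Inner 𝕍 S Y)
      (argsC : (i : Fin (S.ar o).length) → ((S.ar o).get i).2 = true → Y) : Inner 𝕍 S Y

/-- Coinductive positions (holes) of an inner layer. -/
inductive Hole {𝕍 : Type} {S : MBS 𝕍} : Inner 𝕍 S PUnit → Type where
  | top {o : S.Cons} {binds} {argsI} {argsC} (i : Fin (S.ar o).length)
      (h : ((S.ar o).get i).2 = true) : Hole (Inner.op o binds argsI argsC)
  | sub {o : S.Cons} {binds} {argsI} {argsC} (i : Fin (S.ar o).length)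
      (h : ((S.ar o).get i).2 = false) :
      Hole (argsI i h) → Hole (Inner.op o binds argsI argsC)

/-- The polynomial functor `Y ↦ μX.F_Σ(X,Y)`. -/
def MixPF (𝕍 : Type) (S : MBS 𝕍) : PFunctor.{0} :=
  ⟨Inner 𝕍 S PUnit, Hole⟩

/-- Raw mixed terms: the M-type (terminal coalgebra) of `Y ↦ μX.F_Σ(X,Y)`. -/
def TmInf (𝕍 : Type) (S : MBS 𝕍) : Type :=
  PFunctor.M (MixPF 𝕍 S)

/-- Split an element of `μX.F_Σ(X,Y)` into a shape and the values of its holes. -/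
noncomputable def Inner.split {S : MBS 𝕍} {Y : Type} (t : Inner 𝕍 S Y) :
    Σ a : Inner 𝕍 S PUnit, (Hole a → Y) :=
  Inner.rec (motive := fun _ => Σ a : Inner 𝕍 S PUnit, (Hole a → Y))
    (fun x => ⟨.var x, fun h => nomatch h⟩)
    (fun o binds _argsI argsC ihI =>
      ⟨.op o binds (fun i h => (ihI i h).1) (fun _ _ => PUnit.unit),
        fun h =>
          match h with
          | .top i hb => argsC i hb
          | .sub i hb p => (ihI i hb).2 p⟩)
    t

/-- Build a mixed term from one inner layer whose holes carry mixed terms. -/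
noncomputable def mixMk {S : MBS 𝕍} (t : Inner 𝕍 S (TmInf 𝕍 S)) : TmInf 𝕍 S :=
  PFunctor.M.mk t.split

/-- Re-assemble an inner layer from a shape and hole values. -/
def Inner.graft {S : MBS 𝕍} {Y : Type} :
    (a : Inner 𝕍 S PUnit) → (Hole a → Y) → Inner 𝕍 S Y
  | .var x, _ => .var x
  | .op o binds argsI _, g =>
      .op o binds (fun i h => (argsI i h).graft (fun p => g (.sub i h p)))
        (fun i h => g (.top i h))

/-- Expose the top inner layer of a mixed term. -/
def TmInf.expose {S : MBS 𝕍} (t : TmInf 𝕍 S) : Inner 𝕍 S (TmInf 𝕍 S) :=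
  (PFunctor.M.dest t).1.graft (PFunctor.M.dest t).2

/-- Truncation of a shape, given truncations for its holes. -/
def truncShape {S : MBS 𝕍} :
    (a : Inner 𝕍 S PUnit) → (Hole a → TmStar 𝕍 S) → TmStar 𝕍 S
  | .var x, _ => .var x
  | .op o binds argsI _, g =>
      .op o binds (fun i =>
        if h : ((S.ar o).get i).2 = true then g (.top i h)
        else truncShape (argsI i (Bool.eq_false_iff.mpr h)) (fun p => g (.sub i _ p)))

/-- Mixed truncation of a raw mixed term at a given depth. -/
def TmInf.trunc {S : MBS 𝕍} : ℕ → TmInf 𝕍 S → TmStar 𝕍 S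
  | 0, _ => .star
  | n + 1, t =>
      truncShape (PFunctor.M.dest t).1 (fun h => TmInf.trunc n ((PFunctor.M.dest t).2 h))

/-- The Arnold–Nivat metric on raw mixed terms. -/
noncomputable def dInf {S : MBS 𝕍} (t u : TmInf 𝕍 S) : ℝ :=
  sInf {r : ℝ | ∃ n : ℕ, TmInf.trunc n t = TmInf.trunc n u ∧ r = (2 : ℝ)⁻¹ ^ n}

/-- The Arnold–Nivat metric on raw finite terms. -/
noncomputable def dFin {S : MBS 𝕍} (t u : PreTm 𝕍 S) : ℝ :=
  sInf {r : ℝ | ∃ n : ℕ, t.trunc n = u.trunc n ∧ r = (2 : ℝ)⁻¹ ^ n}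

/-- The canonical inclusion of finite terms into mixed terms, inner part. -/
noncomputable def PreTm.embedInner {S : MBS 𝕍} : PreTm 𝕍 S → Inner 𝕍 S (TmInf 𝕍 S)
  | .var x => .var x
  | .op o binds args =>
      .op o binds (fun i _ => (args i).embedInner) (fun i _ => mixMk ((args i).embedInner))

/-- The canonical inclusion of raw finite terms into raw mixed terms. -/
noncomputable def PreTm.embed {S : MBS 𝕍} (t : PreTm 𝕍 S) : TmInf 𝕍 S :=
  mixMk t.embedInner

/-- Cauchy sequences for an explicitly given distance function. -/
def SeqCauchy {X : Type*} (d : X → X → ℝ) (s : ℕ → X) : Prop :=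
  ∀ ε : ℝ, 0 < ε → ∃ N : ℕ, ∀ m ≥ N, ∀ n ≥ N, d (s m) (s n) < ε

/-- Convergence of a sequence for an explicitly given distance function. -/
def SeqTendsto {X : Type*} (d : X → X → ℝ) (s : ℕ → X) (l : X) : Prop :=
  ∀ ε : ℝ, 0 < ε → ∃ N : ℕ, ∀ n ≥ N, d (s n) l < ε

end Fanfic

namespace Fanfic

theorem TmInf.trunc_succ_of_dest {𝕍 : Type} {S : MBS 𝕍} {t : TmInf 𝕍 S} {a : Inner 𝕍 S PUnit}
    {c : Hole a → TmInf 𝕍 S} (h : PFunctor.M.dest t = ⟨a, c⟩) (n : ℕ) :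
    TmInf.trunc (n + 1) t = truncShape a (fun p => TmInf.trunc n (c p)) := by
  rw [TmInf.trunc, h]

theorem trunc_succ_mixMk {𝕍 : Type} {S : MBS 𝕍} (x : Inner 𝕍 S (TmInf 𝕍 S)) (n : ℕ) :
    TmInf.trunc (n + 1) (mixMk x) =
      truncShape x.split.1 (fun p => TmInf.trunc n (x.split.2 p)) :=
  TmInf.trunc_succ_of_dest (PFunctor.M.dest_mk (F := MixPF 𝕍 S) x.split) n

theorem trunc_succ_mixMk_op {𝕍 : Type} {S : MBS 𝕍} (o : S.Cons)
    (binds : (i : Fin (S.ar o).length) → Fin ((S.ar o).get i).1 → 𝕍)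
    (argsI : (i : Fin (S.ar o).length) → ((S.ar o).get i).2 = false → Inner 𝕍 S (TmInf 𝕍 S))
    (argsC : (i : Fin (S.ar o).length) → ((S.ar o).get i).2 = true → TmInf 𝕍 S) (n : ℕ) :
    TmInf.trunc (n + 1) (mixMk (.op o binds argsI argsC)) =
      .op o binds (fun i =>
        if h : ((S.ar o).get i).2 = true then TmInf.trunc n (argsC i h)
        else TmInf.trunc (n + 1) (mixMk (argsI i (Bool.eq_false_iff.mpr h)))) := by
  simp only [trunc_succ_mixMk]
  rfl

theorem PreTm.trunc_zero {𝕍 : Type} {S : MBS 𝕍} (t : PreTm 𝕍 S) : t.trunc 0 = .star := by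
  simp [PreTm.trunc, TmStar.trunc]

theorem PreTm.trunc_succ_op {𝕍 : Type} {S : MBS 𝕍} (o : S.Cons)
    (binds : (i : Fin (S.ar o).length) → Fin ((S.ar o).get i).1 → 𝕍)
    (args : Fin (S.ar o).length → PreTm 𝕍 S) (n : ℕ) :
    (PreTm.op o binds args).trunc (n + 1) =
      .op o binds (fun i => (args i).trunc (if ((S.ar o).get i).2 then n else n + 1)) := by
  simp [PreTm.trunc, PreTm.toStar, TmStar.trunc]

theorem trunc_embed {𝕍 : Type} {S : MBS 𝕍} (t : PreTm 𝕍 S) :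
    ∀ n : ℕ, TmInf.trunc n t.embed = t.trunc n := by
  induction t with
  | var x =>
    rintro (_ | n)
    · rw [PreTm.trunc_zero]; rfl
    · rw [PreTm.embed, trunc_succ_mixMk]
      simp [PreTm.trunc, PreTm.toStar, TmStar.trunc, PreTm.embedInner, Inner.split, truncShape]
  | op o binds args ih =>
    rintro (_ | n)
    · rw [PreTm.trunc_zero]; rfl
    · rw [PreTm.embed, PreTm.embedInner, trunc_succ_mixMk_op, PreTm.trunc_succ_op]
      congr 1
      funext i
      split_ifs with h
      · exact ih i n
      · exact ih i (n + 1)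

theorem PreTm.eq_of_trunc_eq {𝕍 : Type} {S : MBS 𝕍} (t : PreTm 𝕍 S) :
    ∀ u : PreTm 𝕍 S, (∀ n, t.trunc n = u.trunc n) → t = u := by
  induction t with
  | var x =>
    rintro (y | ⟨o, binds, args⟩) h <;> have h1 := h 1 <;>
      simp [PreTm.trunc, PreTm.toStar, TmStar.trunc] at h1
    rw [h1]
  | op o binds args ih =>
    rintro (y | ⟨o', binds', args'⟩) h
    · have h1 := h 1
      simp [PreTm.trunc, PreTm.toStar, TmStar.trunc] at h1
    · have h1 := h 1
      rw [PreTm.trunc_succ_op, PreTm.trunc_succ_op] at h1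
      injection h1 with ho hb _
      subst ho
      obtain rfl := eq_of_heq hb
      congr 1
      funext i
      refine ih i _ fun n => ?_
      have key : ∀ m, (args i).trunc (if ((S.ar o).get i).2 then m else m + 1) =
          (args' i).trunc (if ((S.ar o).get i).2 then m else m + 1) := fun m => by
        have hm := h (m + 1)
        rw [PreTm.trunc_succ_op, PreTm.trunc_succ_op] at hm
        injection hm with _ _ ha
        exact congrFun ha i
      by_cases hc : ((S.ar o).get i).2 = true
      · simpa only [hc, if_true] using key n
      · rcases n with _ | n
        · rw [PreTm.trunc_zero, PreTm.trunc_zero]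
        · simpa only [hc, Bool.false_eq_true, if_false] using key n

theorem exists_trunc_eq_truncShape {𝕍 : Type} {S : MBS 𝕍} (n : ℕ) (a : Inner 𝕍 S PUnit) :
    ∀ g : Hole a → TmStar 𝕍 S, (∀ p, ∃ s : PreTm 𝕍 S, s.trunc n = g p) →
      ∃ s : PreTm 𝕍 S, s.trunc (n + 1) = truncShape a g := by
  induction a with
  | var x =>
    intro g _
    exact ⟨.var x, by simp [PreTm.trunc, PreTm.toStar, TmStar.trunc, truncShape]⟩
  | op o binds argsI argsC ih =>
    intro g hg
    have H : ∀ i, ∃ s : PreTm 𝕍 S, s.trunc (if ((S.ar o).get i).2 then n else n + 1) =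
        if h : ((S.ar o).get i).2 = true then g (.top i h)
        else truncShape (argsI i (Bool.eq_false_iff.mpr h)) (fun p => g (.sub i _ p)) := by
      intro i
      split_ifs with h
      · exact hg _
      · exact ih i _ _ fun p => hg _
    choose s hs using H
    refine ⟨.op o binds s, ?_⟩
    rw [PreTm.trunc_succ_op, truncShape]
    congr 1
    exact funext hs

theorem exists_preTm_trunc_eq {𝕍 : Type} [Nonempty 𝕍] {S : MBS 𝕍} (n : ℕ) :
    ∀ t : TmInf 𝕍 S, ∃ s : PreTm 𝕍 S, s.trunc n = TmInf.trunc n t := by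
  induction n with
  | zero => exact fun t => ⟨.var (Classical.arbitrary 𝕍), PreTm.trunc_zero _⟩
  | succ n ih => exact fun t => exists_trunc_eq_truncShape n _ _ fun p => ih _

theorem trunc_truncShape {𝕍 : Type} {S : MBS 𝕍} (n : ℕ) (a : Inner 𝕍 S PUnit) :
    ∀ g : Hole a → TmStar 𝕍 S,
      (truncShape a g).trunc (n + 1) = truncShape a (fun p => (g p).trunc n) := by
  induction a with
  | var x => intro g; simp [truncShape, TmStar.trunc]
  | op o binds argsI argsC ih =>
    intro g
    rw [truncShape, truncShape, TmStar.trunc]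
    congr 1
    funext i
    split_ifs with h
    · rfl
    · exact ih i _ _

theorem trunc_trunc {𝕍 : Type} {S : MBS 𝕍} (n : ℕ) :
    ∀ (m : ℕ) (t : TmInf 𝕍 S), n ≤ m → (TmInf.trunc m t).trunc n = TmInf.trunc n t := by
  induction n with
  | zero => intro m t _; simp [TmStar.trunc, TmInf.trunc]
  | succ n ih =>
    rintro (_ | m) t h
    · omega
    · exact (trunc_truncShape n _ _).trans
        (congrArg (truncShape _) (funext fun p => ih m _ (by omega)))

theorem trunc_eq_of_le {𝕍 : Type} {S : MBS 𝕍} {n m : ℕ} (h : n ≤ m) {t u : TmInf 𝕍 S}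
    (e : TmInf.trunc m t = TmInf.trunc m u) : TmInf.trunc n t = TmInf.trunc n u := by
  rw [← trunc_trunc n m t h, e, trunc_trunc n m u h]

theorem truncShape_injective {𝕍 : Type} {S : MBS 𝕍} (a : Inner 𝕍 S PUnit) :
    ∀ (a' : Inner 𝕍 S PUnit) (g : Hole a → TmStar 𝕍 S) (g' : Hole a' → TmStar 𝕍 S),
      truncShape a g = truncShape a' g' →
        (⟨a, g⟩ : Σ a : Inner 𝕍 S PUnit, (Hole a → TmStar 𝕍 S)) = ⟨a', g'⟩ := by
  induction a with
  | var x =>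
    rintro (y | ⟨o, binds, argsI, argsC⟩) g g' h <;> simp only [truncShape] at h
    · injection h with h
      subst h
      congr 1
      funext p
      cases p
    · cases h
  | op o binds argsI argsC ih =>
    rintro (y | ⟨o', binds', argsI', argsC'⟩) g g' h <;> simp only [truncShape] at h
    · cases h
    · injection h with ho hb ha
      subst ho
      obtain rfl := eq_of_heq hb
      have ha := congrFun (eq_of_heq ha)
      have hI := fun i (hi : ((S.ar o).get i).2 = false) =>
        ih i hi (argsI' i hi) (fun p => g (.sub i hi p)) (fun p => g' (.sub i hi p))
          (by simpa only [hi, Bool.false_eq_true, dif_neg, not_false_eq_true] using ha i)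
      obtain rfl : argsI = argsI' := by
        funext i hi
        exact congrArg Sigma.fst (hI i hi)
      obtain rfl : argsC = argsC' := Subsingleton.elim _ _
      congr 1
      funext p
      cases p with
      | top i hi => simpa only [hi, dif_pos] using ha i
      | sub i hi p => exact congrFun (eq_of_heq (Sigma.mk.inj (hI i hi)).2) p

/-- Sequences of mixed terms whose `n`-th member is already determined up to depth `n`. -/
def CoherentSeq (𝕍 : Type) (S : MBS 𝕍) : Type :=
  {r : ℕ → TmInf 𝕍 S // ∀ n, TmInf.trunc n (r (n + 1)) = TmInf.trunc n (r n)}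

theorem CoherentSeq.exists_layer {𝕍 : Type} {S : MBS 𝕍} (r : CoherentSeq 𝕍 S) :
    ∃ (a : Inner 𝕍 S PUnit) (c : Hole a → CoherentSeq 𝕍 S),
      ∀ n, PFunctor.M.dest (r.1 (n + 1)) = ⟨a, fun p => (c p).1 n⟩ := by
  have hinj : ∀ n, _ := fun n => truncShape_injective _ _ _ _ (r.2 (n + 1))
  have hshape : ∀ n, (PFunctor.M.dest (r.1 (n + 1))).1 = (PFunctor.M.dest (r.1 1)).1 := by
    intro n
    induction n with
    | zero => rfl
    | succ n ih => exact (congrArg Sigma.fst (hinj n)).trans ih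
  have hc : ∀ n, ∃ c : Hole (PFunctor.M.dest (r.1 1)).1 → TmInf 𝕍 S,
      PFunctor.M.dest (r.1 (n + 1)) = ⟨(PFunctor.M.dest (r.1 1)).1, c⟩ := by
    intro n
    have h := hshape n
    revert h
    generalize (PFunctor.M.dest (r.1 1)).1 = a
    intro h
    subst h
    exact ⟨_, rfl⟩
  choose c hc using hc
  refine ⟨_, fun p => ⟨fun n => c n p, fun n => ?_⟩, hc⟩
  have h := r.2 (n + 1)
  rw [TmInf.trunc_succ_of_dest (hc n), TmInf.trunc_succ_of_dest (hc (n + 1))] at h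
  exact congrFun (eq_of_heq (Sigma.mk.inj (truncShape_injective _ _ _ _ h)).2) p

/-- The mixed term having the `n`-th truncation of the `n`-th member of a coherent sequence. -/
noncomputable def CoherentSeq.limit {𝕍 : Type} {S : MBS 𝕍} (r : CoherentSeq 𝕍 S) : TmInf 𝕍 S :=
  PFunctor.M.corec (F := MixPF 𝕍 S)
    (fun r => ⟨r.exists_layer.choose, r.exists_layer.choose_spec.choose⟩) r

theorem CoherentSeq.trunc_limit {𝕍 : Type} {S : MBS 𝕍} (n : ℕ) :
    ∀ r : CoherentSeq 𝕍 S, TmInf.trunc n r.limit = TmInf.trunc n (r.1 n) := by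
  induction n with
  | zero => intro r; rfl
  | succ n ih =>
    intro r
    have hd : PFunctor.M.dest r.limit =
        ⟨r.exists_layer.choose, fun p => (r.exists_layer.choose_spec.choose p).limit⟩ :=
      PFunctor.M.dest_corec _ _
    rw [TmInf.trunc_succ_of_dest hd,
      TmInf.trunc_succ_of_dest (r.exists_layer.choose_spec.choose_spec n)]
    simp only [ih]

theorem dInf_le {𝕍 : Type} {S : MBS 𝕍} {t u : TmInf 𝕍 S} {n : ℕ}
    (h : TmInf.trunc n t = TmInf.trunc n u) : dInf t u ≤ (2 : ℝ)⁻¹ ^ n := by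
  refine csInf_le ⟨0, ?_⟩ ⟨n, h, rfl⟩
  rintro _ ⟨m, _, rfl⟩
  positivity

theorem trunc_eq_of_dInf_lt {𝕍 : Type} {S : MBS 𝕍} {t u : TmInf 𝕍 S} {n : ℕ}
    (h : dInf t u < (2 : ℝ)⁻¹ ^ n) : TmInf.trunc n t = TmInf.trunc n u := by
  obtain ⟨_, ⟨m, hm, rfl⟩, hlt⟩ := exists_lt_of_csInf_lt (by exact ⟨_, 0, rfl, rfl⟩) h
  have hnm := (pow_lt_pow_iff_right_of_lt_one₀ (by norm_num) (by norm_num)).1 hlt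
  exact trunc_eq_of_le hnm.le hm

theorem exists_inv_two_pow_lt {ε : ℝ} (hε : 0 < ε) : ∃ n : ℕ, (2 : ℝ)⁻¹ ^ n < ε :=
  exists_pow_lt_of_lt_one hε (by norm_num)

theorem seqCauchy_dInf_tendsto {𝕍 : Type} {S : MBS 𝕍} (s : ℕ → TmInf 𝕍 S)
    (hs : SeqCauchy dInf s) : ∃ t : TmInf 𝕍 S, SeqTendsto dInf s t := by
  choose N hN using fun n : ℕ => hs ((2 : ℝ)⁻¹ ^ n) (by positivity)
  let r : CoherentSeq 𝕍 S := ⟨fun n => s (max (N n) (N (n - 1))), fun n =>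
    trunc_eq_of_dInf_lt (hN n _ (by simp) _ (by simp))⟩
  refine ⟨r.limit, fun ε hε => ?_⟩
  obtain ⟨n, hn⟩ := exists_inv_two_pow_lt hε
  refine ⟨N n, fun m hm => (dInf_le ?_).trans_lt hn⟩
  rw [r.trunc_limit]
  exact trunc_eq_of_dInf_lt (hN n m hm _ (le_max_left _ _))

/-- The canonical inclusion `e : T_Σ → T_Σ^∞` is injective,
preserves truncations at every depth (hence is isometric for the Arnold–Nivat
metrics), and has dense image in the complete metric space `(T_Σ^∞, d)`;
consequently `(T_Σ^∞, d)` is a Cauchy completion of `(T_Σ, d)`. -/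
theorem embed_injective_isometric_denseRange
    {𝕍 : Type} [Infinite 𝕍] (S : MBS 𝕍) :
    Function.Injective (PreTm.embed : PreTm 𝕍 S → TmInf 𝕍 S) ∧
    (∀ (t : PreTm 𝕍 S) (n : ℕ), TmInf.trunc n t.embed = t.trunc n) ∧
    (∀ t u : PreTm 𝕍 S, dInf t.embed u.embed = dFin t u) ∧
    (∀ (t : TmInf 𝕍 S) (ε : ℝ), 0 < ε → ∃ s : PreTm 𝕍 S, dInf s.embed t < ε) ∧
    (∀ s : ℕ → TmInf 𝕍 S, SeqCauchy dInf s → ∃ t : TmInf 𝕍 S, SeqTendsto dInf s t) := by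
  refine ⟨fun t u h => t.eq_of_trunc_eq u fun n => ?_, trunc_embed, fun t u => ?_,
    fun t ε hε => ?_, seqCauchy_dInf_tendsto⟩
  · rw [← trunc_embed, ← trunc_embed, h]
  · simp only [dInf, dFin, trunc_embed]
  · obtain ⟨n, hn⟩ := exists_inv_two_pow_lt hε
    obtain ⟨s, hs⟩ := exists_preTm_trunc_eq n t
    exact ⟨s, (dInf_le ((trunc_embed s n).trans hs)).trans_lt hn⟩

end Fanfic
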